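/- arXiv:quant-ph/9504010 — 3 statements merged into one kernel-verified Lean document; each statement's English description precedes it below -/
import Mathlib

section
/- Let n ∈ ℕ, ħ > 0, masses m : Fin n → ℝ with m j > 0 for all j, and V : ℝⁿ → ℝ. Suppose ψ : ℝ × ℝⁿ → ℂ is twice continuously differentiable and satisfies the Schrödinger equation iħ ∂ψ/∂t = −Σ_j (ħ²/(2·m j)) ∂_j²ψ + Vψ at every point. Then at every point (t,q) with ψ(t,q) ≠ 0, the density ρ(t,q) = |ψ(t,q)|² satisfies the continuity equation associated with the Bohmian particle motion: ∂ρ/∂t(t,q) + Σ_j ∂_j (ρ(t,·) · v^{ψ(t,·)}_j)(q) = 0. -/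
open Complex

/-- Partial derivative of `f : ℝⁿ → ℂ` in the `j`-th coordinate direction. -/
noncomputable def partialDeriv (n : ℕ) (f : (Fin n → ℝ) → ℂ) (j : Fin n)
    (q : Fin n → ℝ) : ℂ :=
  fderiv ℝ f q (Pi.single j 1)

/-- If `ψ` is twice continuously differentiable and satisfies the Schrödinger equation
at every point, then at every point `(t,q)` where `ψ(t,q) ≠ 0` the density
`ρ = |ψ|²` satisfies the continuity equation of the Bohmian particle motion,
`∂ρ/∂t + Σ_j ∂_j (ρ v^ψ_j) = 0`, with `v^ψ_j = (ħ/m_j) Im(∂_jψ/ψ)`. -/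
theorem continuity_equation_of_schroedinger (n : ℕ) (hbar : ℝ) (hhb : 0 < hbar)
    (m : Fin n → ℝ) (hm : ∀ j, 0 < m j) (V : (Fin n → ℝ) → ℝ)
    (ψ : ℝ × (Fin n → ℝ) → ℂ) (hψ : ContDiff ℝ 2 ψ)
    (hSch : ∀ t q, Complex.I * (hbar : ℂ) * fderiv ℝ ψ (t, q) (1, 0) =
      -∑ j, ((hbar ^ 2 / (2 * m j) : ℝ) : ℂ) *
          partialDeriv n (fun q' => partialDeriv n (fun q'' => ψ (t, q'')) j q') j q
        + (V q : ℂ) * ψ (t, q)) :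
    ∀ t q, ψ (t, q) ≠ 0 →
      deriv (fun s => Complex.normSq (ψ (s, q))) t
        + ∑ j, fderiv ℝ
            (fun q' => Complex.normSq (ψ (t, q')) *
              ((hbar / m j) * (partialDeriv n (fun q'' => ψ (t, q'')) j q' / ψ (t, q')).im))
            q (Pi.single j 1) = 0 := by
  intro t q _
  have hf : ContDiff ℝ 2 (fun q'' => ψ (t, q'')) := by fun_prop
  have hfd : Differentiable ℝ (fun q'' => ψ (t, q'')) := hf.differentiable (by norm_num)
  have hD : ∀ j, Differentiable ℝ (fun q' => partialDeriv n (fun q'' => ψ (t, q'')) j q') := by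
    intro j
    have h1 : ContDiff ℝ 1 (fderiv ℝ (fun q'' => ψ (t, q''))) :=
      hf.fderiv_right (by norm_num)
    have h2 := h1.differentiable (by norm_num)
    unfold partialDeriv
    exact fun x => (h2 x).clm_apply (differentiableAt_const _)
  have key : ∀ j, fderiv ℝ
            (fun q' => Complex.normSq (ψ (t, q')) *
              ((hbar / m j) * (partialDeriv n (fun q'' => ψ (t, q'')) j q' / ψ (t, q')).im))
            q (Pi.single j 1) = (hbar / m j) *
      ((partialDeriv n (fun q' => partialDeriv n (fun q'' => ψ (t, q'')) j q') j q).im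
          * (ψ (t, q)).re -
       (partialDeriv n (fun q' => partialDeriv n (fun q'' => ψ (t, q'')) j q') j q).re
          * (ψ (t, q)).im) := by
    intro j
    have hDj := hD j
    have e1 : (partialDeriv n (fun q'' => ψ (t, q'')) j q) =
      fderiv ℝ (fun q'' => ψ (t, q'')) q (Pi.single j 1) := rfl
    have e2 : partialDeriv n (fun q' => partialDeriv n (fun q'' => ψ (t, q'')) j q') j q =
      fderiv ℝ (fun q' => partialDeriv n (fun q'' => ψ (t, q'')) j q') q (Pi.single j 1) := rfl
    rw [e2]
    have e3 : (fun q' => Complex.normSq (ψ (t, q')) *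
              ((hbar / m j) * (partialDeriv n (fun q'' => ψ (t, q'')) j q' / ψ (t, q')).im)) =
        fun q' => (hbar / m j) * ((partialDeriv n (fun q'' => ψ (t, q'')) j q').im
          * (ψ (t, q')).re - (partialDeriv n (fun q'' => ψ (t, q'')) j q').re
          * (ψ (t, q')).im) := by
      funext q'
      by_cases h : ψ (t, q') = 0
      · simp [h]
      · have h' : Complex.normSq (ψ (t, q')) ≠ 0 := by simpa using h
        rw [Complex.div_im]
        field_simp
    rw [e3]
    have a1 := (hfd q).hasFDerivAt
    have a2 := (hDj q).hasFDerivAt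
    have r1 := Complex.reCLM.hasFDerivAt.comp q a1
    have i1 := Complex.imCLM.hasFDerivAt.comp q a1
    have r2 := Complex.reCLM.hasFDerivAt.comp q a2
    have i2 := Complex.imCLM.hasFDerivAt.comp q a2
    have H := ((i2.mul r1).sub (r2.mul i1)).const_mul (hbar / m j)
    have H' := congrArg (fun L => L (Pi.single j 1)) H.fderiv
    refine Eq.trans H' ?_
    simp only [ContinuousLinearMap.smul_apply, ContinuousLinearMap.sub_apply,
      ContinuousLinearMap.add_apply, ContinuousLinearMap.comp_apply, Function.comp_apply,
      Complex.reCLM_apply, Complex.imCLM_apply, smul_eq_mul, ← e1]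
    ring
  have time : deriv (fun s => Complex.normSq (ψ (s, q))) t =
      2 * ((ψ (t, q)).re * (fderiv ℝ ψ (t, q) (1, 0)).re
        + (ψ (t, q)).im * (fderiv ℝ ψ (t, q) (1, 0)).im) := by
    have a0 : HasFDerivAt ψ (fderiv ℝ ψ (t, q)) (t, q) :=
      ((hψ.differentiable (by norm_num)) (t, q)).hasFDerivAt
    have a1 : HasDerivAt (fun s : ℝ => ψ (s, q)) (fderiv ℝ ψ (t, q) (1, 0)) t :=
      a0.comp_hasDerivAt t ((hasDerivAt_id t).prodMk (hasDerivAt_const t q))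
    have r1 := Complex.reCLM.hasFDerivAt.comp_hasDerivAt t a1
    have i1 := Complex.imCLM.hasFDerivAt.comp_hasDerivAt t a1
    have H := (r1.mul r1).add (i1.mul i1)
    refine Eq.trans H.deriv ?_
    simp only [Function.comp_apply, Complex.reCLM_apply, Complex.imCLM_apply]
    ring
  rw [time, Finset.sum_congr rfl (fun j _ => key j)]
  have hS := hSch t q
  generalize fderiv ℝ ψ (t, q) (1, 0) = w at *
  generalize ψ (t, q) = z at *
  generalize hd : (fun j => partialDeriv n
    (fun q' => partialDeriv n (fun q'' => ψ (t, q'')) j q') j q) = d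
  have hd' := fun j => congrFun hd j
  simp only [hd'] at hS ⊢
  have hre := congrArg Complex.re hS
  have him := congrArg Complex.im hS
  simp only [Complex.add_re, Complex.add_im, Complex.neg_re, Complex.neg_im, Complex.re_sum,
    Complex.im_sum, Complex.re_ofReal_mul, Complex.im_ofReal_mul, mul_assoc,
    Complex.I_mul_re, Complex.I_mul_im] at hre him
  have hsum : hbar * ∑ j, hbar / m j * ((d j).im * z.re - (d j).re * z.im) =
      2 * z.re * ∑ j, hbar ^ 2 / (2 * m j) * (d j).im
        - 2 * z.im * ∑ j, hbar ^ 2 / (2 * m j) * (d j).re := by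
    rw [Finset.mul_sum, Finset.mul_sum, Finset.mul_sum, ← Finset.sum_sub_distrib]
    refine Finset.sum_congr rfl fun j _ => ?_
    have := (hm j).ne'
    field_simp
  apply mul_left_cancel₀ hhb.ne'
  rw [mul_add, hsum]
  linear_combination 2 * z.re * him - 2 * z.im * hre
end

section
/- Let n ∈ ℕ, let v : ℝ × ℝⁿ → ℝⁿ be continuously differentiable, and let ρ : ℝ × ℝⁿ → ℝ be continuously differentiable, nonnegative, with ρ(0,·) integrable with respect to Lebesgue measure, satisfying the continuity equation ∂ρ/∂t(t,x) + Σ_j ∂_j(ρ(t,·) · v_j(t,·))(x) = 0 at every point. Let φ : ℝ × ℝⁿ → ℝⁿ be a flow of v, i.e., φ(0,x) = x for all x, ∂φ/∂t(t,x) = v(t, φ(t,x)) for all (t,x), φ is continuously differentiable jointly in (t,x), and for each t the map φ(t,·) is a C¹ diffeomorphism of ℝⁿ onto itself. Then for every t, the pushforward of the measure with density ρ(0,·) under φ(t,·) equals the measure with density ρ(t,·): Measure.map (φ(t,·)) (volume.withDensity ρ(0,·)) = volume.withDensity ρ(t,·). -/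
open MeasureTheory

theorem aux_upd {n : ℕ} (N : Fin n → Fin n → ℝ) (b : Fin n → ℝ) (i : Fin n) :
    (Matrix.detRowAlternating (n := Fin n) (R := ℝ)) (Function.update N i (∑ k, b k • N k))
      = b i * (Matrix.detRowAlternating (n := Fin n) (R := ℝ)) N := by
  rw [AlternatingMap.map_update_sum, Finset.sum_eq_single i]
  · rw [AlternatingMap.map_update_smul, Function.update_eq_self]
    rfl
  · intro k _ hk
    rw [AlternatingMap.map_update_smul, AlternatingMap.map_update_self _ _ hk.symm, smul_zero]
  · simp

theorem aux_det {n : ℕ} (M : ℝ → Matrix (Fin n) (Fin n) ℝ) (B : Matrix (Fin n) (Fin n) ℝ) (t : ℝ)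
    (h : ∀ i, HasDerivAt (fun s => M s i) ((B * M t) i) t) :
    HasDerivAt (fun s => (M s).det) (B.trace * (M t).det) t := by
  let D : ContinuousMultilinearMap ℝ (fun _ : Fin n => (Fin n → ℝ)) ℝ :=
    { (Matrix.detRowAlternating (n := Fin n) (R := ℝ)).toMultilinearMap with
      cont := by
        show Continuous (fun M : Matrix (Fin n) (Fin n) ℝ => M.det)
        exact Continuous.matrix_det continuous_id }
  have h1 : HasDerivAt (fun s => (fun i => M s i)) (fun i => (B * M t) i) t :=
    hasDerivAt_pi.2 h
  have h2 := (D.hasFDerivAt (fun i => M t i)).comp_hasDerivAt t h1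
  have h3 : D.linearDeriv (fun i => M t i) (fun i => (B * M t) i) = B.trace * (M t).det := by
    rw [ContinuousMultilinearMap.linearDeriv_apply, Matrix.trace, Finset.sum_mul]
    refine Finset.sum_congr rfl fun i _ => ?_
    have e : (B * M t) i = ∑ k, B i k • M t k := by
      ext j
      simp [Matrix.mul_apply]
    rw [e]
    exact aux_upd (fun k => M t k) (B i) i
  rw [← h3]
  exact h2

theorem aux_var {n : ℕ} (v : ℝ × (Fin n → ℝ) → (Fin n → ℝ)) (hv : ContDiff ℝ 1 v)
    (φ : ℝ × (Fin n → ℝ) → (Fin n → ℝ)) (hφ : ContDiff ℝ 1 φ)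
    (hφ' : ∀ t x, HasDerivAt (fun s => φ (s, x)) (v (t, φ (t, x))) t) (t : ℝ) (x : Fin n → ℝ) :
    HasDerivAt (fun s => (fderiv ℝ φ (s, x)).comp (ContinuousLinearMap.inr ℝ ℝ (Fin n → ℝ)))
      (((fderiv ℝ v (t, φ (t, x))).comp (ContinuousLinearMap.inr ℝ ℝ (Fin n → ℝ))).comp
        ((fderiv ℝ φ (t, x)).comp (ContinuousLinearMap.inr ℝ ℝ (Fin n → ℝ)))) t := by
  set R := ContinuousLinearMap.inr ℝ ℝ (Fin n → ℝ) with hR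
  have cφ : Continuous φ := hφ.continuous
  have cv : Continuous v := hv.continuous
  have cdφ : Continuous (fderiv ℝ φ) := hφ.continuous_fderiv (by norm_num)
  have cdv : Continuous (fderiv ℝ v) := hv.continuous_fderiv (by norm_num)
  have dx : ∀ s y, HasFDerivAt (fun y => φ (s, y)) ((fderiv ℝ φ (s, y)).comp R) y := fun s y =>
    ((hφ.differentiable (by norm_num)) (s, y)).hasFDerivAt.comp y (hasFDerivAt_prodMk_right s y)
  have dvx : ∀ s y, HasFDerivAt (fun y => v (s, y)) ((fderiv ℝ v (s, y)).comp R) y := fun s y =>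
    ((hv.differentiable (by norm_num)) (s, y)).hasFDerivAt.comp y (hasFDerivAt_prodMk_right s y)
  let F' : (Fin n → ℝ) → ℝ → ((Fin n → ℝ) →L[ℝ] (Fin n → ℝ)) := fun y s =>
    ((fderiv ℝ v (s, φ (s, y))).comp R).comp ((fderiv ℝ φ (s, y)).comp R)
  have cF' : Continuous (fun p : ℝ × (Fin n → ℝ) => F' p.2 p.1) := by
    refine Continuous.clm_comp (Continuous.clm_comp ?_ continuous_const)
      (Continuous.clm_comp ?_ continuous_const)
    · exact cdv.comp (by fun_prop)
    · exact cdφ.comp (by fun_prop)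
  have cF'x : ∀ y, Continuous (F' y) := fun y =>
    cF'.comp (f := fun s : ℝ => (s, y)) (by fun_prop)
  have key : ∀ s, (fderiv ℝ φ (s, x)).comp R
      = (fderiv ℝ φ (0, x)).comp R + ∫ r in (0:ℝ)..s, F' x r := by
    intro s
    obtain ⟨C, hC⟩ := ((isCompact_uIcc (a := (0:ℝ)) (b := s)).prod
      (isCompact_closedBall x 1)).exists_bound_of_continuousOn cF'.continuousOn
    have h1 : HasFDerivAt (fun y => ∫ r in (0:ℝ)..s, v (r, φ (r, y)))
        (∫ r in (0:ℝ)..s, F' x r) x := by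
      refine intervalIntegral.hasFDerivAt_integral_of_dominated_of_fderiv_le
        (s := Metric.closedBall x 1) (bound := fun _ => C)
        (Metric.closedBall_mem_nhds x one_pos) ?_ ?_ ?_ ?_ ?_ ?_
      · refine Filter.Eventually.of_forall fun y => ?_
        exact Continuous.aestronglyMeasurable (by fun_prop)
      · exact Continuous.intervalIntegrable (by fun_prop) _ _
      · exact (cF'x x).aestronglyMeasurable
      · exact Filter.Eventually.of_forall fun r hr y hy =>
          hC (r, y) ⟨Set.uIoc_subset_uIcc hr, hy⟩
      · exact intervalIntegrable_const
      · exact Filter.Eventually.of_forall fun r hr y hy =>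
          HasFDerivAt.comp (g := fun z => v (r, z)) y (dvx r (φ (r, y))) (dx r y)
    have h2 : (fun y => ∫ r in (0:ℝ)..s, v (r, φ (r, y))) = fun y => φ (s, y) - φ (0, y) := by
      ext1 y
      exact intervalIntegral.integral_eq_sub_of_hasDerivAt (fun r _ => hφ' r y)
        (Continuous.intervalIntegrable (by fun_prop) _ _)
    rw [h2] at h1
    rw [← ((dx s x).sub (dx 0 x)).unique h1]
    abel
  have h3 : HasDerivAt (fun s => (fderiv ℝ φ (0, x)).comp R + ∫ r in (0:ℝ)..s, F' x r)
      (F' x t) t := by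
    refine HasDerivAt.const_add _ ?_
    exact intervalIntegral.integral_hasDerivAt_right ((cF'x x).intervalIntegrable _ _)
      ((cF'x x).stronglyMeasurableAtFilter _ _) (cF'x x).continuousAt
  rw [show (fun s => (fderiv ℝ φ (s, x)).comp R) = _ from funext key]
  exact h3

theorem aux_vec {n : ℕ} (L : (Fin n → ℝ) →L[ℝ] ℝ) (w : Fin n → ℝ) :
    L w = ∑ j, w j * L (Pi.single j 1) := by
  conv_lhs => rw [pi_eq_sum_univ' w]
  simp

/-- Transport theorem: if a nonnegative `C¹` density `ρ` with integrable initial datum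
satisfies the continuity equation `∂ρ/∂t + div(ρ v) = 0` for a `C¹` vector field `v`,
and `φ` is a flow of `v` (each time-`t` map being a `C¹` diffeomorphism of `ℝⁿ`), then
for every `t` the pushforward under `φ(t,·)` of the measure with density `ρ(0,·)` is the
measure with density `ρ(t,·)`. -/
theorem transport_of_continuity_equation (n : ℕ)
    (v : ℝ × (Fin n → ℝ) → (Fin n → ℝ)) (hv : ContDiff ℝ 1 v)
    (ρ : ℝ × (Fin n → ℝ) → ℝ) (hρ : ContDiff ℝ 1 ρ)
    (hρ_nonneg : ∀ p, 0 ≤ ρ p)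
    (hρ_int : Integrable (fun x => ρ (0, x)) volume)
    (hcont : ∀ t x, fderiv ℝ ρ (t, x) (1, 0)
      + ∑ j, fderiv ℝ (fun y => ρ (t, y) * v (t, y) j) x (Pi.single j 1) = 0)
    (φ : ℝ × (Fin n → ℝ) → (Fin n → ℝ)) (hφ : ContDiff ℝ 1 φ)
    (hφ0 : ∀ x, φ (0, x) = x)
    (hφ' : ∀ t x, HasDerivAt (fun s => φ (s, x)) (v (t, φ (t, x))) t)
    (hφdiffeo : ∀ t, ∃ ι : (Fin n → ℝ) → (Fin n → ℝ), ContDiff ℝ 1 ι ∧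
      Function.LeftInverse ι (fun x => φ (t, x)) ∧
      Function.RightInverse ι (fun x => φ (t, x))) :
    ∀ t, Measure.map (fun x => φ (t, x))
        (volume.withDensity (fun x => ENNReal.ofReal (ρ (0, x))))
      = volume.withDensity (fun x => ENNReal.ofReal (ρ (t, x))) := by
  set R := ContinuousLinearMap.inr ℝ ℝ (Fin n → ℝ) with hR
  have dx : ∀ s y, HasFDerivAt (fun y => φ (s, y)) ((fderiv ℝ φ (s, y)).comp R) y := fun s y =>
    ((hφ.differentiable (by norm_num)) (s, y)).hasFDerivAt.comp y (hasFDerivAt_prodMk_right s y)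
  have dvx : ∀ s y, HasFDerivAt (fun y => v (s, y)) ((fderiv ℝ v (s, y)).comp R) y := fun s y =>
    ((hv.differentiable (by norm_num)) (s, y)).hasFDerivAt.comp y (hasFDerivAt_prodMk_right s y)
  have dρx : ∀ s y, HasFDerivAt (fun y => ρ (s, y)) ((fderiv ℝ ρ (s, y)).comp R) y := fun s y =>
    ((hρ.differentiable (by norm_num)) (s, y)).hasFDerivAt.comp y (hasFDerivAt_prodMk_right s y)
  have hdet : ∀ t x, HasDerivAt (fun s => ((fderiv ℝ φ (s, x)).comp R).det)
      ((∑ j, fderiv ℝ v (t, φ (t, x)) (0, Pi.single j 1) j) *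
        ((fderiv ℝ φ (t, x)).comp R).det) t := by
    intro t x
    have h := aux_var v hv φ hφ hφ' t x
    have h1 := aux_det (fun s => LinearMap.toMatrix' (((fderiv ℝ φ (s, x)).comp R) : (Fin n → ℝ) →ₗ[ℝ] (Fin n → ℝ)))
      (LinearMap.toMatrix' (((fderiv ℝ v (t, φ (t, x))).comp R) : (Fin n → ℝ) →ₗ[ℝ] (Fin n → ℝ))) t ?_
    · simp only [LinearMap.det_toMatrix'] at h1
      have h9 : (LinearMap.toMatrix' (((fderiv ℝ v (t, φ (t, x))).comp R) :
          (Fin n → ℝ) →ₗ[ℝ] (Fin n → ℝ))).trace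
          = ∑ j, fderiv ℝ v (t, φ (t, x)) (0, Pi.single j 1) j := by
        simp [Matrix.trace, LinearMap.toMatrix'_apply, hR]
      rw [h9] at h1
      exact h1
    · intro i
      rw [← LinearMap.toMatrix'_comp]
      refine hasDerivAt_pi.2 fun j => ?_
      have h2 := (hasDerivAt_pi.1 (h.clm_apply (hasDerivAt_const t (Pi.single j (1:ℝ))))) i
      convert h2 using 1
      · ext s
        simp [LinearMap.toMatrix'_apply, hR]
      · rw [map_zero, add_zero]
        simp [LinearMap.toMatrix'_apply, hR]
  have hconst : ∀ t x, ρ (t, φ (t, x)) * ((fderiv ℝ φ (t, x)).comp R).det = ρ (0, x) := by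
    intro t x
    have hd : ∀ t, HasDerivAt (fun s => ρ (s, φ (s, x)) * ((fderiv ℝ φ (s, x)).comp R).det) 0 t := by
      intro t
      have h1 : HasDerivAt (fun s => ρ (s, φ (s, x)))
          (fderiv ℝ ρ (t, φ (t, x)) (1, v (t, φ (t, x)))) t :=
        ((hρ.differentiable (by norm_num)) (t, φ (t, x))).hasFDerivAt.comp_hasDerivAt t
          ((hasDerivAt_id t).prodMk (hφ' t x))
      have h2 := h1.mul (hdet t x)
      refine h2.congr_deriv ?_
      set y := φ (t, x)
      have h3 : ∀ j, fderiv ℝ (fun y => ρ (t, y) * v (t, y) j) y (Pi.single j 1)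
          = ρ (t, y) * fderiv ℝ v (t, y) (0, Pi.single j 1) j
            + v (t, y) j * fderiv ℝ ρ (t, y) (0, Pi.single j 1) := by
        intro j
        have h8 : HasFDerivAt (fun y => ρ (t, y) * v (t, y) j) _ y :=
          (dρx t y).mul (hasFDerivAt_pi'.1 (dvx t y) j)
        rw [h8.fderiv]
        simp [hR]
      have h4 := hcont t y
      simp only [h3, Finset.sum_add_distrib, ← Finset.mul_sum] at h4
      have h5 := aux_vec ((fderiv ℝ ρ (t, y)).comp R) (v (t, y))
      have h6 : fderiv ℝ ρ (t, y) (1, v (t, y))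
          = fderiv ℝ ρ (t, y) (1, 0) + ((fderiv ℝ ρ (t, y)).comp R) (v (t, y)) := by
        simp [hR, ← map_add]
      have h7 : ∀ j, ((fderiv ℝ ρ (t, y)).comp R) (Pi.single j 1)
          = fderiv ℝ ρ (t, y) (0, Pi.single j 1) := fun j => by simp [hR]
      simp only [h7] at h5
      rw [h6, h5]
      linear_combination (((fderiv ℝ φ (t, x)).comp R).det) * h4
    have h0 := is_const_of_deriv_eq_zero (fun t => (hd t).differentiableAt)
      (fun t => (hd t).deriv) t 0
    have hid : (fderiv ℝ φ (0, x)).comp R = ContinuousLinearMap.id ℝ _ := by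
      have h8 := dx 0 x
      simp only [hφ0] at h8
      exact h8.unique (hasFDerivAt_id x)
    rw [hid, hφ0] at h0
    simpa [ContinuousLinearMap.det] using h0
  intro t
  obtain ⟨ι, hι, hl, hr⟩ := hφdiffeo t
  have hm : Measurable (fun x => φ (t, x)) :=
    (hφ.continuous.comp (by fun_prop : Continuous fun x : Fin n → ℝ => (t, x))).measurable
  ext B hB
  have hpre : MeasurableSet ((fun x => φ (t, x)) ⁻¹' B) := hm hB
  rw [Measure.map_apply hm hB, withDensity_apply _ hB, withDensity_apply _ hpre]
  have himg : (fun x => φ (t, x)) '' ((fun x => φ (t, x)) ⁻¹' B) = B :=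
    Set.image_preimage_eq _ hr.surjective
  have hcv := lintegral_image_eq_lintegral_abs_det_fderiv_mul volume hpre
    (fun x _ => (dx t x).hasFDerivWithinAt) hl.injective.injOn
    (fun x => ENNReal.ofReal (ρ (t, x)))
  rw [himg] at hcv
  rw [hcv]
  refine lintegral_congr fun x => ?_
  rw [← ENNReal.ofReal_mul (abs_nonneg _), ← abs_of_nonneg (hρ_nonneg (t, φ (t, x))), ← abs_mul,
    mul_comm, hconst, abs_of_nonneg (hρ_nonneg _)]
end

section
/- Let n ∈ ℕ, ħ > 0, masses m : Fin n → ℝ with m j > 0 for all j, and V : ℝⁿ → ℝ. (a) If ψ : ℝ × ℝⁿ → ℂ is twice continuously differentiable and satisfies iħ ∂ψ/∂t = −Σ_j (ħ²/(2·m j)) ∂_j²ψ + Vψ at every point, then the time-reversed wave function ψᵀ(t,q) := conj(ψ(−t,q)) satisfies the same Schrödinger equation at every point. (b) If moreover Q : ℝ → ℝⁿ is differentiable, ψ(t,Q(t)) ≠ 0 for all t, and Q satisfies the guiding equation dQ_j/dt(t) = (ħ/m j)·Im(∂_jψ(t,Q(t))/ψ(t,Q(t))) for all t and j, then Qᵀ(t)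 := Q(−t) satisfies the guiding equation for ψᵀ: dQᵀ_j/dt(t) = (ħ/m j)·Im(∂_jψᵀ(t,Qᵀ(t))/ψᵀ(t,Qᵀ(t))) for all t and j. -/
open Complex

theorem partialDeriv_conj_aux (n : ℕ) (f : (Fin n → ℝ) → ℂ) (j : Fin n) (q : Fin n → ℝ) :
    partialDeriv n (fun q' => (starRingEnd ℂ) (f q')) j q
      = (starRingEnd ℂ) (partialDeriv n f j q) := by
  unfold partialDeriv
  have h := Complex.conjCLE.comp_fderiv (f := f) (x := q)
  have h2 : (fun q' => (starRingEnd ℂ) (f q')) = Complex.conjCLE ∘ f := by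
    funext x; simp
  rw [h2, h]
  simp

/-- Time-reversal invariance of Bohmian mechanics. (a) If `ψ` is `C²` and satisfies the
Schrödinger equation `iħ ∂ψ/∂t = −Σ_j (ħ²/(2 m_j)) ∂_j²ψ + Vψ` at every point, then
`ψᵀ(t,q) = conj(ψ(−t,q))` satisfies the same equation at every point. (b) If moreover a
differentiable trajectory `Q` with `ψ(t,Q(t)) ≠ 0` satisfies the guiding equation
`dQ_j/dt = (ħ/m_j) Im(∂_jψ(t,Q(t))/ψ(t,Q(t)))`, then `Qᵀ(t) = Q(−t)` satisfies the guiding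
equation for `ψᵀ`. -/
theorem time_reversal_invariance (n : ℕ) (hbar : ℝ) (hhb : 0 < hbar)
    (m : Fin n → ℝ) (hm : ∀ j, 0 < m j) (V : (Fin n → ℝ) → ℝ)
    (ψ : ℝ × (Fin n → ℝ) → ℂ) (hψ : ContDiff ℝ 2 ψ)
    (hSch : ∀ t q, Complex.I * (hbar : ℂ) * fderiv ℝ ψ (t, q) (1, 0) =
      -∑ j, ((hbar ^ 2 / (2 * m j) : ℝ) : ℂ) *
          partialDeriv n (fun q' => partialDeriv n (fun q'' => ψ (t, q'')) j q') j q
        + (V q : ℂ) * ψ (t, q)) :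
    (∀ t q, Complex.I * (hbar : ℂ) *
        fderiv ℝ (fun p : ℝ × (Fin n → ℝ) => (starRingEnd ℂ) (ψ (-p.1, p.2))) (t, q) (1, 0) =
      -∑ j, ((hbar ^ 2 / (2 * m j) : ℝ) : ℂ) *
          partialDeriv n (fun q' =>
            partialDeriv n (fun q'' => (starRingEnd ℂ) (ψ (-t, q''))) j q') j q
        + (V q : ℂ) * (starRingEnd ℂ) (ψ (-t, q))) ∧
    (∀ Q : ℝ → (Fin n → ℝ), Differentiable ℝ Q → (∀ t, ψ (t, Q t) ≠ 0) →
      (∀ t j, deriv (fun s => Q s j) t =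
        (hbar / m j) * (partialDeriv n (fun q => ψ (t, q)) j (Q t) / ψ (t, Q t)).im) →
      ∀ t j, deriv (fun s => Q (-s) j) t =
        (hbar / m j) *
          (partialDeriv n (fun q => (starRingEnd ℂ) (ψ (-t, q))) j (Q (-t)) /
            (starRingEnd ℂ) (ψ (-t, Q (-t)))).im) := by
  refine ⟨?_, ?_⟩
  · intro t q
    simp only [partialDeriv_conj_aux]
    have hd : DifferentiableAt ℝ ψ (-t, q) := (hψ.differentiable (by norm_num)) _
    have hL : HasFDerivAt (fun p : ℝ × (Fin n → ℝ) => (-p.1, p.2))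
        ((-ContinuousLinearMap.fst ℝ ℝ (Fin n → ℝ)).prod
          (ContinuousLinearMap.snd ℝ ℝ (Fin n → ℝ))) (t, q) :=
      (hasFDerivAt_fst.neg).prodMk hasFDerivAt_snd
    have hc : HasFDerivAt (fun p : ℝ × (Fin n → ℝ) => ψ (-p.1, p.2)) _ (t, q) :=
      HasFDerivAt.comp (t, q) (g := ψ) hd.hasFDerivAt hL
    have hf := (Complex.conjCLE.toContinuousLinearMap.hasFDerivAt
      (x := ψ (-t, q))).comp (t, q) hc
    have he : fderiv ℝ (fun p : ℝ × (Fin n → ℝ) => (starRingEnd ℂ) (ψ (-p.1, p.2))) (t, q) (1, 0)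
        = - (starRingEnd ℂ) (fderiv ℝ ψ (-t, q) (1, 0)) := by
      have h1 : fderiv ℝ (fun p : ℝ × (Fin n → ℝ) => (starRingEnd ℂ) (ψ (-p.1, p.2))) (t, q)
        = _ := hf.fderiv
      rw [h1]
      have h2 : ((-1 : ℝ), (0 : Fin n → ℝ)) = -(1, 0) := by simp
      simp [h2, -Prod.neg_mk]
    rw [he]
    have h := congrArg (starRingEnd ℂ) (hSch (-t) q)
    simp only [map_mul, map_add, map_neg, map_sum, Complex.conj_I, Complex.conj_ofReal] at h
    rw [← h]
    ring
  · intro Q _ _ hQ t j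
    have h := deriv_comp_neg (fun s => Q s j) t
    rw [h, hQ, partialDeriv_conj_aux, ← map_div₀, Complex.conj_im]
    ring
end
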